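/- arXiv:2302.14798 — 2 statements merged into one kernel-verified Lean document; each statement's English description precedes it below -/
import Mathlib

section
/- Let (ρ_{AB}, {Π^i}_{i=1}^N, {D^i}_{i=1}^N) be a |C|-dimensional teleportation protocol such that each state ω^i = (id_A⊗D^i)(ρ_{AB}) satisfies the reduction criterion ω^i ≤ ρ_A⊗I_C, where ρ_A = tr_B(ρ_{AB}). Then the entanglement fidelity satisfies F(Λ) ≤ 1/|C|. -/
open Matrix BigOperators Finset
open scoped Kronecker ComplexOrder

noncomputable section

/-- Partial trace over the second tensor factor. -/
def ptraceB {α β : Type*} [Fintype β] (M : Matrix (α × β) (α × β) ℂ) :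
    Matrix α α ℂ :=
  Matrix.of fun a a' => ∑ b, M (a, b) (a', b)

/-- `ρ ↦ ∑ k (I ⊗ K k) ρ (I ⊗ K k)†`: a Kraus-operator channel `B → C` applied to the
second factor of a bipartite matrix on `A ⊗ B`. -/
def idKrausApply {a b c : ℕ} {m : ℕ} (K : Fin m → Matrix (Fin c) (Fin b) ℂ)
    (ρ : Matrix (Fin a × Fin b) (Fin a × Fin b) ℂ) :
    Matrix (Fin a × Fin c) (Fin a × Fin c) ℂ :=
  ∑ k, ((1 : Matrix (Fin a) (Fin a) ℂ) ⊗ₖ K k) * ρ *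
      ((1 : Matrix (Fin a) (Fin a) ℂ) ⊗ₖ K k)ᴴ

/-- The teleportation channel `Λ(σ) = ∑ i tr_{AC'}[(Πᵢ ⊗ I_C)(σ ⊗ ωᵢ)]`, written entrywise. -/
def teleChannel {a c N : ℕ}
    (Pv ω : Fin N → Matrix (Fin a × Fin c) (Fin a × Fin c) ℂ)
    (σ : Matrix (Fin c) (Fin c) ℂ) : Matrix (Fin c) (Fin c) ℂ :=
  Matrix.of fun x y =>
    ∑ i, ∑ a₁ : Fin a, ∑ x₁ : Fin c, ∑ a₂ : Fin a, ∑ x₂ : Fin c,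
      Pv i (a₁, x₁) (a₂, x₂) * σ x₂ x₁ * ω i (a₂, x) (a₁, y)

/-- The maximally entangled state `|Φ⁺⟩⟨Φ⁺|` with `|Φ⁺⟩ = c^{-1/2} ∑ᵢ |i⟩|i⟩`. -/
def maxEnt (c : ℕ) : Matrix (Fin c × Fin c) (Fin c × Fin c) ℂ :=
  Matrix.of fun p q => if p.1 = p.2 ∧ q.1 = q.2 then (1 : ℂ) / c else 0

/-- `(id ⊗ Λ)(M)`, written entrywise (this is the correct formula for linear `Λ`). -/
def idOnFirst {c d : ℕ} (Λ : Matrix (Fin c) (Fin c) ℂ → Matrix (Fin c) (Fin c) ℂ)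
    (M : Matrix (Fin d × Fin c) (Fin d × Fin c) ℂ) :
    Matrix (Fin d × Fin c) (Fin d × Fin c) ℂ :=
  Matrix.of fun p q => Λ (Matrix.of fun x y => M (p.1, x) (q.1, y)) p.2 q.2

/-- Entanglement fidelity `F(Λ) = tr[Φ⁺ (id ⊗ Λ)(Φ⁺)]` of the teleportation channel
determined by the POVM `Pv` and the encoded states `ω`. -/
def entFid {a c N : ℕ}
    (Pv ω : Fin N → Matrix (Fin a × Fin c) (Fin a × Fin c) ℂ) : ℂ :=
  Matrix.trace (maxEnt c * idOnFirst (teleChannel Pv ω) (maxEnt c))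

/-- Mutual information (base 2) of a joint probability distribution on a product of
finite sets; terms with `p x y = 0` vanish since `0 * log = 0`. -/
def mutInfo {X Y : Type*} [Fintype X] [Fintype Y] (p : X → Y → ℝ) : ℝ :=
  ∑ x, ∑ y, p x y * Real.logb 2 (p x y / ((∑ y', p x y') * (∑ x', p x' y)))

/-- Binary entropy (base 2). -/
def binEnt (p : ℝ) : ℝ := -(p * Real.logb 2 p) - (1 - p) * Real.logb 2 (1 - p)

/-- The swap operator on `ℂ^d ⊗ ℂ^d`. -/
def swapOp (d : ℕ) : Matrix (Fin d × Fin d) (Fin d × Fin d) ℂ :=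
  Matrix.of fun p q => if p.1 = q.2 ∧ p.2 = q.1 then 1 else 0

open scoped MatrixOrder Matrix.Norms.L2Operator in
/-- The product of two positive semidefinite matrices has nonnegative trace. -/
theorem trace_mul_nonneg_of_posSemidef {n : Type*} [Fintype n] [DecidableEq n]
    {P Q : Matrix n n ℂ}
    (hP : P.PosSemidef) (hQ : Q.PosSemidef) : 0 ≤ (P * Q).trace := by
  obtain ⟨B, rfl⟩ := CStarAlgebra.nonneg_iff_eq_star_mul_self.mp hP.nonneg
  rw [Matrix.mul_assoc, Matrix.trace_mul_comm]
  exact (hQ.mul_mul_conjTranspose_same B).trace_nonneg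

theorem trace_ptraceB {α β : Type*} [Fintype α] [Fintype β]
    (M : Matrix (α × β) (α × β) ℂ) : (ptraceB M).trace = M.trace := by
  simp [Matrix.trace, ptraceB, Fintype.sum_prod_type]

/-- Pairing with the maximally entangled state averages the entries `((k, k), (j, j))`. -/
theorem trace_maxEnt_mul {c : ℕ} (M : Matrix (Fin c × Fin c) (Fin c × Fin c) ℂ) :
    (maxEnt c * M).trace = (1 / c : ℂ) * ∑ j, ∑ k, M (k, k) (j, j) := by
  simp [Matrix.trace, Matrix.mul_apply, maxEnt, Fintype.sum_prod_type, ite_and, Finset.mul_sum]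

/-- The entanglement fidelity is `|C|⁻² ∑ᵢ tr(Πᵢ ωᵢ)`. -/
theorem entFid_eq_sum_trace {a c N : ℕ}
    (Pv ω : Fin N → Matrix (Fin a × Fin c) (Fin a × Fin c) ℂ) :
    entFid Pv ω = (1 / c : ℂ) * (1 / c) * ∑ i, (Pv i * ω i).trace := by
  have key (j k : Fin c) :
      idOnFirst (teleChannel Pv ω) (maxEnt c) (k, k) (j, j) =
        (1 / c : ℂ) * ∑ i, ∑ a₁, ∑ a₂, Pv i (a₁, j) (a₂, k) * ω i (a₂, k) (a₁, j) := by
    simp only [idOnFirst, teleChannel, maxEnt, Matrix.of_apply, ite_and, mul_ite, ite_mul,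
      mul_zero, zero_mul, Finset.sum_ite_eq, Finset.mem_univ, if_true, Finset.mul_sum]
    refine Finset.sum_congr rfl fun i _ => Finset.sum_congr rfl fun a₁ _ => ?_
    rw [Finset.sum_comm]
    refine Finset.sum_congr rfl fun a₂ _ => ?_
    simp [mul_comm, mul_left_comm]
  rw [entFid, trace_maxEnt_mul]
  simp_rw [key, ← Finset.mul_sum]
  rw [← mul_assoc]
  congr 1
  simp only [Matrix.trace, Matrix.diag_apply, Matrix.mul_apply, Fintype.sum_prod_type]
  calc _ = ∑ j, ∑ i, ∑ k, ∑ a₁, ∑ a₂, Pv i (a₁, j) (a₂, k) * ω i (a₂, k) (a₁, j) :=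
        Finset.sum_congr rfl fun j _ => Finset.sum_comm
    _ = ∑ i, ∑ j, ∑ k, ∑ a₁, ∑ a₂, Pv i (a₁, j) (a₂, k) * ω i (a₂, k) (a₁, j) :=
        Finset.sum_comm
    _ = _ := by
        refine Finset.sum_congr rfl fun i _ => ?_
        refine Eq.trans (Finset.sum_congr rfl fun j _ => ?_) Finset.sum_comm
        rw [Finset.sum_comm]
        exact Finset.sum_congr rfl fun a₁ _ => Finset.sum_comm

/-- if every encoded state `ωᵢ = (id ⊗ Dᵢ)(ρ)` satisfies the reduction
criterion `ωᵢ ≤ ρ_A ⊗ I_C`, then the entanglement fidelity is at most `1/|C|`. -/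
theorem stmt_4 {a b c N m : ℕ} (hc : 0 < c)
    (ρ : Matrix (Fin a × Fin b) (Fin a × Fin b) ℂ)
    (hρ : ρ.PosSemidef) (hρtr : ρ.trace = 1)
    (Pv : Fin N → Matrix (Fin a × Fin c) (Fin a × Fin c) ℂ)
    (hPv : ∀ i, (Pv i).PosSemidef) (hPvsum : ∑ i, Pv i = 1)
    (K : Fin N → Fin m → Matrix (Fin c) (Fin b) ℂ)
    (hK : ∀ i, ∑ k, (K i k)ᴴ * K i k = 1)
    (hred : ∀ i,
      ((ptraceB ρ) ⊗ₖ (1 : Matrix (Fin c) (Fin c) ℂ) - idKrausApply (K i) ρ).PosSemidef) :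
    entFid Pv (fun i => idKrausApply (K i) ρ) ≤ 1 / (c : ℂ) := by
  have hc' : (c : ℂ) ≠ 0 := Nat.cast_ne_zero.mpr hc.ne'
  set R := ptraceB ρ ⊗ₖ (1 : Matrix (Fin c) (Fin c) ℂ) with hR
  have hRtr : R.trace = c := by
    rw [hR, Matrix.trace_kronecker, trace_ptraceB, hρtr]
    simp
  have hle (i : Fin N) : (Pv i * idKrausApply (K i) ρ).trace ≤ (Pv i * R).trace := by
    have h := trace_mul_nonneg_of_posSemidef (hPv i) (hred i)
    rwa [Matrix.mul_sub, Matrix.trace_sub, sub_nonneg] at h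
  have hsum : ∑ i, (Pv i * R).trace = c := by
    rw [← Matrix.trace_sum, ← Finset.sum_mul, hPvsum, one_mul, hRtr]
  have hpos : (0 : ℂ) ≤ 1 / c * (1 / c) := by
    have h : (0 : ℝ) ≤ 1 / c * (1 / c) := by positivity
    simpa using Complex.zero_le_real.mpr h
  calc entFid Pv (fun i => idKrausApply (K i) ρ)
      = 1 / c * (1 / c) * ∑ i, (Pv i * idKrausApply (K i) ρ).trace := entFid_eq_sum_trace _ _
    _ ≤ 1 / c * (1 / c) * ∑ i, (Pv i * R).trace :=
        mul_le_mul_of_nonneg_left (Finset.sum_le_sum fun i _ => hle i) hpos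
    _ = 1 / (c : ℂ) := by rw [hsum]; field_simp
end
end

section
/- Fix a bipartite state ρ_{AB}, a number of messages N ≥ 1, and a channel dimension |C| ≥ 1. There exists an N-message dense coding protocol over a |C|-dimensional quantum channel using ρ_{AB} with classical correlation fidelity F_cl(W) > |C|/N if and only if |C|/N < 1 and there exists a quantum channel E : B→C (given by Kraus operators) such that ω_{AC} = (id_A⊗E)(ρ_{AB}) violates the reduction criterion, i.e., ρ_A⊗I_C − ω_{AC} is not positive semidefinite (where ρ_A = tr_B ρ_{AB}). -/
open Matrix BigOperators Finset
open scoped Kronecker ComplexOrder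

noncomputable section

open scoped MatrixOrder in
/-- The trace of a product of two positive semidefinite matrices is nonnegative. -/
theorem trace_mul_nonneg_of_posSemidef_s15 {n : Type*} [Fintype n] {A B : Matrix n n ℂ}
    (hA : A.PosSemidef) (hB : B.PosSemidef) : 0 ≤ (A * B).trace := by
  classical
  obtain ⟨X, rfl⟩ := CStarAlgebra.nonneg_iff_eq_star_mul_self.mp hA.nonneg
  rw [star_eq_conjTranspose, mul_assoc, trace_mul_comm]
  exact (hB.mul_mul_conjTranspose_same X).trace_nonneg

theorem idKrausApply_posSemidef {a b c m : ℕ} (K : Fin m → Matrix (Fin c) (Fin b) ℂ)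
    {ρ : Matrix (Fin a × Fin b) (Fin a × Fin b) ℂ} (hρ : ρ.PosSemidef) :
    (idKrausApply K ρ).PosSemidef :=
  posSemidef_sum _ fun _ _ => hρ.mul_mul_conjTranspose_same _

theorem trace_idKrausApply {a b c m : ℕ} {K : Fin m → Matrix (Fin c) (Fin b) ℂ}
    (hK : ∑ k, (K k)ᴴ * K k = 1) (ρ : Matrix (Fin a × Fin b) (Fin a × Fin b) ℂ) :
    (idKrausApply K ρ).trace = ρ.trace := by
  have h (k : Fin m) : (((1 : Matrix (Fin a) (Fin a) ℂ) ⊗ₖ K k) * ρ *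
      ((1 : Matrix (Fin a) (Fin a) ℂ) ⊗ₖ K k)ᴴ).trace =
      (((1 : Matrix (Fin a) (Fin a) ℂ) ⊗ₖ ((K k)ᴴ * K k)) * ρ).trace := by
    rw [trace_mul_comm, ← Matrix.mul_assoc, conjTranspose_kronecker, ← mul_kronecker_mul,
      conjTranspose_one, one_mul]
  have hsum : ∑ k, (1 : Matrix (Fin a) (Fin a) ℂ) ⊗ₖ ((K k)ᴴ * K k) =
      (1 : Matrix (Fin a) (Fin a) ℂ) ⊗ₖ ∑ k, ((K k)ᴴ * K k) := by
    ext p q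
    simp [Matrix.sum_apply, Finset.mul_sum]
  rw [idKrausApply, trace_sum, Finset.sum_congr rfl fun k _ => h k, ← trace_sum,
    ← Finset.sum_mul, hsum, hK, one_kronecker_one, one_mul]

/-- Kraus operators of the channel replacing every state by the basis state `i`. -/
def replaceKraus {b c : ℕ} (i : Fin c) (j : Fin b) : Matrix (Fin c) (Fin b) ℂ :=
  Matrix.single i j 1

theorem sum_conjTranspose_mul_replaceKraus {b c : ℕ} (i : Fin c) :
    ∑ j : Fin b, (replaceKraus i j)ᴴ * replaceKraus i j = 1 := by
  ext p q
  simp [replaceKraus, Matrix.conjTranspose_single, Matrix.sum_apply, Matrix.single_apply, Matrix.one_apply, ite_and]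

theorem idKrausApply_replaceKraus {a b c : ℕ} (i : Fin c)
    (ρ : Matrix (Fin a × Fin b) (Fin a × Fin b) ℂ) :
    idKrausApply (replaceKraus i) ρ = ptraceB ρ ⊗ₖ Matrix.single i i 1 := by
  ext ⟨p, x⟩ ⟨q, y⟩
  simp [idKrausApply, ptraceB, replaceKraus, Matrix.sum_apply, Matrix.mul_apply,
    Fintype.sum_prod_type, Matrix.single_apply, Matrix.one_apply, ite_and, apply_ite (starRingEnd ℂ)]
  split_ifs <;> simp

theorem sum_kronecker_single {α : Type*} {c : ℕ} (M : Matrix α α ℂ) :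
    ∑ i : Fin c, M ⊗ₖ Matrix.single i i (1 : ℂ) = M ⊗ₖ (1 : Matrix (Fin c) (Fin c) ℂ) := by
  ext p q
  simp [Matrix.sum_apply, Matrix.single_apply, Matrix.one_apply, ite_and]

theorem idKrausApply_append_zero {a b c m n : ℕ} (K : Fin m → Matrix (Fin c) (Fin b) ℂ)
    (ρ : Matrix (Fin a × Fin b) (Fin a × Fin b) ℂ) :
    idKrausApply (Fin.append K (0 : Fin n → Matrix (Fin c) (Fin b) ℂ)) ρ =
      idKrausApply K ρ := by
  simp [idKrausApply, Fin.sum_univ_add]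

theorem idKrausApply_zero_append {a b c m n : ℕ} (K : Fin n → Matrix (Fin c) (Fin b) ℂ)
    (ρ : Matrix (Fin a × Fin b) (Fin a × Fin b) ℂ) :
    idKrausApply (Fin.append (0 : Fin m → Matrix (Fin c) (Fin b) ℂ) K) ρ =
      idKrausApply K ρ := by
  simp [idKrausApply, Fin.sum_univ_add]

theorem trace_vecMulVec_star_mul {n : Type*} [Fintype n] (x : n → ℂ) (M : Matrix n n ℂ) :
    (vecMulVec x (star x) * M).trace = star x ⬝ᵥ (M *ᵥ x) := by
  rw [vecMulVec_mul, trace_vecMulVec, dotProduct_comm, dotProduct_mulVec]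

/-- Damping the measurement `Q` by `1 - t P` costs at most `2 t tr (P S)` on a state `S`
supported on `Q`. -/
theorem trace_damped_mul {n : Type*} [Fintype n] [DecidableEq n] {P Q S : Matrix n n ℂ}
    (hP : P.PosSemidef) (hQ : Q.PosSemidef) (hS : S.PosSemidef)
    (hQS : Q * S = S) (hSQ : S * Q = S) (t : ℝ) :
    S.trace - 2 * t * (P * S).trace ≤
      ((1 - (t : ℂ) • P) * Q * (1 - (t : ℂ) • P) * S).trace := by
  have hnn := trace_mul_nonneg_of_posSemidef_s15 (hQ.conjTranspose_mul_mul_same P) hS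
  rw [hP.1.eq] at hnn
  have hexp : (1 - (t : ℂ) • P) * Q * (1 - (t : ℂ) • P) * S =
      Q * S - (t : ℂ) • (P * (Q * S)) - (t : ℂ) • (Q * (P * S)) +
        ((t : ℂ) ^ 2) • (P * Q * P * S) := by
    simp only [sub_mul, mul_sub, one_mul, mul_one, smul_mul_assoc, mul_smul_comm, mul_assoc]
    module
  have hcyc : (Q * (P * S)).trace = (P * S).trace := by
    rw [trace_mul_comm, mul_assoc, hSQ]
  have ht : (0 : ℂ) ≤ (t : ℂ) ^ 2 := by exact_mod_cast sq_nonneg t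
  rw [hexp, hQS, trace_add, trace_sub, trace_sub, trace_smul, trace_smul, trace_smul, hcyc,
    ← sub_nonneg]
  convert mul_nonneg ht hnn using 1
  simp only [smul_eq_mul]
  ring

theorem trace_mul_le_one_of_povm {n ι : Type*} [Fintype n] [DecidableEq n] [Fintype ι]
    {Pv : ι → Matrix n n ℂ} (hPv : ∀ i, (Pv i).PosSemidef) (hsum : ∑ i, Pv i = 1)
    {ω : Matrix n n ℂ} (hω : ω.PosSemidef) (i : ι) : (Pv i * ω).trace ≤ ω.trace := by
  classical
  calc (Pv i * ω).trace ≤ ∑ j, (Pv j * ω).trace :=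
        Finset.single_le_sum (f := fun j => (Pv j * ω).trace)
          (fun j _ => trace_mul_nonneg_of_posSemidef_s15 (hPv j) hω) (Finset.mem_univ i)
    _ = ω.trace := by rw [← trace_sum, ← Finset.sum_mul, hsum, one_mul]

/-- If the reduction criterion fails for `E`, then some protocol with `c + 1 + k` messages
has total success weight exceeding `c`. -/
theorem exists_protocol_of_not_reduction {a b c m : ℕ} (k : ℕ)
    {ρ : Matrix (Fin a × Fin b) (Fin a × Fin b) ℂ} (hρ : ρ.PosSemidef) (hρtr : ρ.trace = 1)
    {E : Fin m → Matrix (Fin c) (Fin b) ℂ} (hE : ∑ k, (E k)ᴴ * E k = 1)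
    (hred : ¬ ((ptraceB ρ) ⊗ₖ (1 : Matrix (Fin c) (Fin c) ℂ) - idKrausApply E ρ).PosSemidef) :
    ∃ (m : ℕ) (K : Fin (c + (k + 1)) → Fin m → Matrix (Fin c) (Fin b) ℂ)
        (Pv : Fin (c + (k + 1)) → Matrix (Fin a × Fin c) (Fin a × Fin c) ℂ),
        (∀ i, ∑ k, (K i k)ᴴ * K i k = 1) ∧
          (∀ i, (Pv i).PosSemidef) ∧ (∑ i, Pv i = 1) ∧
          (c : ℂ) < ∑ i, Matrix.trace (Pv i * idKrausApply (K i) ρ) := by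
  set ω := idKrausApply E ρ with hω
  set R := (ptraceB ρ) ⊗ₖ (1 : Matrix (Fin c) (Fin c) ℂ) with hR
  let S (i : Fin c) := (ptraceB ρ) ⊗ₖ Matrix.single i i (1 : ℂ)
  let Q (i : Fin c) := (1 : Matrix (Fin a) (Fin a) ℂ) ⊗ₖ Matrix.single i i (1 : ℂ)
  have hSR : ∑ i, S i = R := sum_kronecker_single _
  have hQ1 : ∑ i, Q i = 1 := by rw [sum_kronecker_single, one_kronecker_one]
  have hS (i : Fin c) : (S i).PosSemidef := by
    rw [show S i = _ from (idKrausApply_replaceKraus i ρ).symm]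
    exact idKrausApply_posSemidef _ hρ
  have hQ (i : Fin c) : (Q i).PosSemidef := by
    refine Matrix.PosSemidef.one.kronecker ?_
    simpa [Matrix.conjTranspose_single] using
      posSemidef_conjTranspose_mul_self (Matrix.single i i (1 : ℂ))
  have hQS (i : Fin c) : Q i * S i = S i := by simp [Q, S, ← mul_kronecker_mul]
  have hSQ (i : Fin c) : S i * Q i = S i := by simp [Q, S, ← mul_kronecker_mul]
  have hRpos : R.PosSemidef := hSR ▸ posSemidef_sum _ fun i _ => hS i
  have hωpos : ω.PosSemidef := idKrausApply_posSemidef _ hρ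
  have hRtr : R.trace = c := by simp [hR, trace_kronecker, trace_ptraceB, hρtr]
  obtain ⟨x, hx⟩ : ∃ x, ¬ 0 ≤ star x ⬝ᵥ ((R - ω) *ᵥ x) := by
    by_contra! h
    exact hred (.of_dotProduct_mulVec_nonneg (hRpos.1.sub hωpos.1) h)
  set P := vecMulVec x (star x) with hPdef
  have hP : P.PosSemidef := posSemidef_vecMulVec_self_star x
  rw [← trace_vecMulVec_star_mul, ← hPdef, mul_sub, trace_sub] at hx
  obtain ⟨r, hr, hrP⟩ := RCLike.nonneg_iff_exists_ofReal.mp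
    (trace_mul_nonneg_of_posSemidef_s15 hP hRpos)
  obtain ⟨w, hw, hwP⟩ := RCLike.nonneg_iff_exists_ofReal.mp
    (trace_mul_nonneg_of_posSemidef_s15 hP hωpos)
  obtain ⟨s, hs, hsx⟩ := RCLike.nonneg_iff_exists_ofReal.mp (dotProduct_star_self_nonneg x)
  have hPP : P * P = (s : ℂ) • P := by
    rw [hPdef, vecMulVec_mul_vecMulVec, ← hsx, vecMulVec_smul]
    rfl
  have hrw : r < w := by
    rw [← hrP, ← hwP] at hx
    by_contra! h
    exact hx (by rw [sub_nonneg]; exact_mod_cast h)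
  obtain ⟨t, ht, hts, hgain⟩ : ∃ t : ℝ, 0 < t ∧ t * s ≤ 1 ∧
      0 < 2 * t * (w - r) - t ^ 2 * s * w := by
    have hsw : 0 ≤ s * w := mul_nonneg hs hw
    refine ⟨(w - r) / (s * w + 1), div_pos (by linarith) (by linarith), ?_, ?_⟩
    · rw [div_mul_eq_mul_div, div_le_one (by linarith)]
      nlinarith
    · have : 2 * ((w - r) / (s * w + 1)) * (w - r) -
          ((w - r) / (s * w + 1)) ^ 2 * s * w =
          (w - r) ^ 2 * (s * w + 2) / (s * w + 1) ^ 2 := by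
        field_simp
        ring
      rw [this]
      have := sub_pos.mpr hrw
      positivity
  let T : Matrix (Fin a × Fin c) (Fin a × Fin c) ℂ := 1 - (t : ℂ) • P
  have hT : Tᴴ = T := by simp [T, hP.1.eq]
  have hTT : T * T = 1 - ((2 * t - t ^ 2 * s : ℝ) : ℂ) • P := by
    simp only [T, sub_mul, mul_sub, one_mul, mul_one, smul_mul_assoc, mul_smul_comm, hPP]
    push_cast
    module
  let P₀ := ((2 * t - t ^ 2 * s : ℝ) : ℂ) • P
  have hP₀ : P₀.PosSemidef := by
    refine hP.smul ?_
    have : 0 ≤ 2 * t - t ^ 2 * s := by nlinarith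
    exact_mod_cast this
  refine ⟨m + b,
    Fin.append (fun i => Fin.append 0 (replaceKraus i)) (fun _ => Fin.append E 0),
    Fin.append (fun i => T * Q i * T) (Fin.cons P₀ 0), ?_, ?_, ?_, ?_⟩
  · intro i
    refine Fin.addCases (fun i => ?_) (fun i => ?_) i
    · simp [Fin.sum_univ_add, sum_conjTranspose_mul_replaceKraus]
    · simp [Fin.sum_univ_add, hE]
  · intro i
    refine Fin.addCases (fun i => ?_) (fun i => ?_) i
    · simpa [hT] using (hQ i).mul_mul_conjTranspose_same T
    · refine Fin.cases ?_ (fun i => ?_) i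
      · simpa using hP₀
      · simpa using Matrix.PosSemidef.zero
  · simp only [Fin.sum_univ_add, Fin.sum_univ_succ, Fin.append_left, Fin.append_right,
      Fin.cons_zero, Fin.cons_succ, Pi.zero_apply, Finset.sum_const_zero, add_zero,
      ← Finset.sum_mul, ← Finset.mul_sum, hQ1, mul_one, hTT]
    exact sub_add_cancel _ _
  · simp only [Fin.sum_univ_add, Fin.sum_univ_succ, Fin.append_left, Fin.append_right,
      Fin.cons_zero, Fin.cons_succ, idKrausApply_append_zero, idKrausApply_zero_append,
      idKrausApply_replaceKraus, Pi.zero_apply, zero_mul, trace_zero, Finset.sum_const_zero,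
      add_zero, ← hω]
    have hP₀ω : (P₀ * ω).trace = ((2 * t - t ^ 2 * s : ℝ) : ℂ) * w := by
      simp only [P₀, smul_mul_assoc, trace_smul, smul_eq_mul, ← hwP]
      rfl
    have hlow : (c : ℂ) - 2 * t * r ≤ ∑ i, (T * Q i * T * S i).trace := by
      calc (c : ℂ) - 2 * t * r = ∑ i, ((S i).trace - 2 * t * (P * S i).trace) := by
            rw [Finset.sum_sub_distrib, ← Finset.mul_sum, ← trace_sum, ← trace_sum,
              ← Finset.mul_sum, hSR, hRtr, ← hrP]
            rfl
        _ ≤ _ := Finset.sum_le_sum fun i _ =>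
            trace_damped_mul hP (hQ i) (hS i) (hQS i) (hSQ i) t
    have hgap : (c : ℂ) < c - 2 * t * r + ((2 * t - t ^ 2 * s : ℝ) : ℂ) * w := by
      have : (c : ℝ) < c - 2 * t * r + (2 * t - t ^ 2 * s) * w := by linarith
      exact_mod_cast this
    rw [hP₀ω]
    exact hgap.trans_le (add_le_add_left hlow _)

/-- there exists an `N`-message dense coding protocol over a
`|C|`-dimensional channel using `ρ` with classical correlation fidelity exceeding
`|C|/N` iff `|C|/N < 1` and some channel `E : B → C` produces
`ω = (id ⊗ E)(ρ)` violating the reduction criterion. -/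
theorem stmt_15 {a b : ℕ} (N c : ℕ) (hN : 0 < N) (hc : 0 < c)
    (ρ : Matrix (Fin a × Fin b) (Fin a × Fin b) ℂ)
    (hρ : ρ.PosSemidef) (hρtr : ρ.trace = 1) :
    (∃ (m : ℕ) (K : Fin N → Fin m → Matrix (Fin c) (Fin b) ℂ)
        (Pv : Fin N → Matrix (Fin a × Fin c) (Fin a × Fin c) ℂ),
        (∀ i, ∑ k, (K i k)ᴴ * K i k = 1) ∧
          (∀ i, (Pv i).PosSemidef) ∧ (∑ i, Pv i = 1) ∧
          (c : ℂ) / (N : ℂ) <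
            (1 / (N : ℂ)) * ∑ i, Matrix.trace (Pv i * idKrausApply (K i) ρ)) ↔
      ((c : ℝ) / (N : ℝ) < 1 ∧
        ∃ (m : ℕ) (E : Fin m → Matrix (Fin c) (Fin b) ℂ),
          (∑ k, (E k)ᴴ * E k = 1) ∧
            ¬ ((ptraceB ρ) ⊗ₖ (1 : Matrix (Fin c) (Fin c) ℂ) -
                idKrausApply E ρ).PosSemidef) := by
  have hN' : (0 : ℝ) < N := by exact_mod_cast hN
  have hiff (x : ℂ) : (c : ℂ) / N < 1 / N * x ↔ (c : ℂ) < x := by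
    have hNC : (0 : ℂ) < N := by exact_mod_cast hN
    rw [div_eq_inv_mul, one_div]
    exact mul_lt_mul_iff_right₀ (inv_pos.mpr hNC)
  simp only [hiff, div_lt_one hN', Nat.cast_lt]
  constructor
  · rintro ⟨m, K, Pv, hK, hPv, hsum, hlt⟩
    have hω (i : Fin N) := idKrausApply_posSemidef (K i) hρ
    constructor
    · have hle : ∑ i, (Pv i * idKrausApply (K i) ρ).trace ≤ ∑ i : Fin N, (1 : ℂ) :=
        Finset.sum_le_sum fun i _ => by
          simpa [trace_idKrausApply (hK i), hρtr] using
            trace_mul_le_one_of_povm hPv hsum (hω i) i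
      have := hlt.trans_le hle
      simpa using this
    · by_contra! h
      refine hlt.not_ge ?_
      calc ∑ i, (Pv i * idKrausApply (K i) ρ).trace
          ≤ ∑ i, (Pv i * (ptraceB ρ ⊗ₖ (1 : Matrix (Fin c) (Fin c) ℂ))).trace :=
            Finset.sum_le_sum fun i _ => by
              rw [← sub_nonneg, ← trace_sub, ← mul_sub]
              exact trace_mul_nonneg_of_posSemidef_s15 (hPv i) (h m (K i) (hK i))
        _ = c := by
            rw [← trace_sum, ← Finset.sum_mul, hsum, one_mul, trace_kronecker, trace_ptraceB,
              hρtr]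
            simp
  · rintro ⟨hcN, m, E, hE, hred⟩
    obtain ⟨k, rfl⟩ := Nat.exists_eq_add_of_lt hcN
    exact exists_protocol_of_not_reduction k hρ hρtr hE hred
end
end
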